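/- Let A, B ⊆ ℝ be compact sets, let θ ∈ (0,1), and let α, β > 0 with α + β ≤ 1. Suppose there exist nonzero finite Borel measures μ supported on A and ν supported on B such that J_{α,θ}(μ) < ∞ and J_{β,1−θ}(ν) < ∞, where J_{s,θ}(μ) = ( ∫_ℝ |μ̂(ξ)|^{2/θ} |ξ|^{s/θ − 1} dξ )^{θ}. Then the difference set A − B = { a − b : a ∈ A, b ∈ B } satisfies dim_H (A − B) ≥ α + β. -/

import Mathlib

open MeasureTheory Real
open scoped ENNReal

/-- The Fourier transform `μ̂(ξ) = ∫ e^{-2πiξx} dμ(x)` of a measure on `ℝ`. -/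
noncomputable def measureFourier (μ : Measure ℝ) (ξ : ℝ) : ℂ :=
  ∫ x, Complex.exp (-(2 * π * ξ * x) * Complex.I) ∂μ

/-- The `(s,θ)`-energy `J_{s,θ}(μ) = (∫ |μ̂(ξ)|^{2/θ} |ξ|^{s/θ-1} dξ)^θ`. -/
noncomputable def energyJ (μ : Measure ℝ) (s θ : ℝ) : ℝ≥0∞ :=
  (∫⁻ ξ : ℝ, ENNReal.ofReal (‖measureFourier μ ξ‖ ^ (2 / θ) * |ξ| ^ (s / θ - 1))) ^ θ

/-- The law of `x - y` under the product of `μ` and `ν`. -/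
noncomputable def diffMeasure (μ ν : Measure ℝ) : Measure ℝ :=
  (μ.prod ν).map fun p => p.1 - p.2

instance isFiniteMeasure_diffMeasure (μ ν : Measure ℝ) [IsFiniteMeasure μ] [IsFiniteMeasure ν] :
    IsFiniteMeasure (diffMeasure μ ν) := by
  unfold diffMeasure; infer_instance

lemma measureFourier_eq_charFun (μ : Measure ℝ) (ξ : ℝ) :
    measureFourier μ ξ = charFun μ (-(2 * π * ξ)) := by
  rw [measureFourier, charFun_apply_real]
  push_cast
  simp only [neg_mul]

lemma measurable_measureFourier (μ : Measure ℝ) [IsFiniteMeasure μ] :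
    Measurable (measureFourier μ) := by
  have : measureFourier μ = fun ξ => charFun μ (-(2 * π * ξ)) :=
    funext (measureFourier_eq_charFun μ)
  rw [this]
  exact measurable_charFun.comp (by fun_prop)

lemma measureFourier_diffMeasure (μ ν : Measure ℝ) [IsFiniteMeasure μ] [IsFiniteMeasure ν] (ξ : ℝ) :
    measureFourier (diffMeasure μ ν) ξ =
      measureFourier μ ξ * (starRingEnd ℂ) (measureFourier ν ξ) := by
  rw [measureFourier_eq_charFun ν, ← charFun_neg, neg_neg, measureFourier, diffMeasure,
    integral_map (by fun_prop) (by fun_prop), measureFourier, charFun_apply_real,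
    ← integral_prod_mul]
  refine integral_congr_ae (ae_of_all _ fun p => ?_)
  simp only [← Complex.exp_add]
  congr 1
  push_cast
  ring

/-- A Gaussian is the Fourier transform of a Gaussian. -/
lemma ofReal_exp_neg_sq_div_eq_integral {r : ℝ} (hr : 0 < r) (x : ℝ) :
    ((rexp (-π * x ^ 2 / r ^ 2) : ℝ) : ℂ) =
      r * ∫ ξ : ℝ, Complex.exp (-(2 * π * ξ * x) * Complex.I) * (rexp (-π * r ^ 2 * ξ ^ 2) : ℝ) := by
  have hb : 0 < ((π * r ^ 2 : ℝ) : ℂ).re := by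
    rw [Complex.ofReal_re]; positivity
  have h := fourierIntegral_gaussian hb (-(2 * π * x))
  have h1 : ((π : ℂ) / ((π * r ^ 2 : ℝ) : ℂ)) ^ (1 / 2 : ℂ) = ((r⁻¹ : ℝ) : ℂ) := by
    have : (π : ℂ) / ((π * r ^ 2 : ℝ) : ℂ) = (((r⁻¹) ^ 2 : ℝ) : ℂ) := by
      rw [← Complex.ofReal_div]
      congr 1
      have := pi_ne_zero
      field_simp
    rw [this, show (1 / 2 : ℂ) = ((1 / 2 : ℝ) : ℂ) by push_cast; rfl,
      ← Complex.ofReal_cpow (by positivity), ← sqrt_eq_rpow, sqrt_sq (by positivity)]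
  have h2 : ∫ ξ : ℝ, Complex.exp (-(2 * π * ξ * x) * Complex.I) * (rexp (-π * r ^ 2 * ξ ^ 2) : ℝ)
      = ((r⁻¹ : ℝ) : ℂ) * Complex.exp (-(-(2 * π * x)) ^ 2 / (4 * ((π * r ^ 2 : ℝ) : ℂ))) := by
    rw [← h1, ← h]
    refine integral_congr_ae (ae_of_all _ fun ξ => ?_)
    simp only [Complex.ofReal_exp]
    congr 2
    · ring
    · push_cast; ring
  have hr' : (r : ℂ) ≠ 0 := by exact_mod_cast hr.ne'
  have hpi : (π : ℂ) ≠ 0 := by exact_mod_cast pi_ne_zero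
  rw [h2, Complex.ofReal_exp, ← mul_assoc, ← Complex.ofReal_mul, mul_inv_cancel₀ hr.ne',
    Complex.ofReal_one, one_mul]
  congr 1
  push_cast
  field_simp
  ring

lemma lintegral_gaussian_le (σ : Measure ℝ) [IsFiniteMeasure σ] {r : ℝ} (hr : 0 < r) :
    ∫⁻ x, ENNReal.ofReal (rexp (-π * x ^ 2 / r ^ 2)) ∂σ ≤
      ENNReal.ofReal r *
        ∫⁻ ξ : ℝ, ENNReal.ofReal (‖measureFourier σ ξ‖ * rexp (-π * r ^ 2 * ξ ^ 2)) := by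
  have hint : Integrable (fun x => rexp (-π * x ^ 2 / r ^ 2)) σ := by
    refine Integrable.of_bound (by fun_prop) 1 (ae_of_all _ fun x => ?_)
    rw [norm_of_nonneg (exp_pos _).le, exp_le_one_iff, neg_mul, neg_div]
    exact neg_nonpos.2 (by positivity)
  have hgauss : Integrable (fun ξ : ℝ => rexp (-π * r ^ 2 * ξ ^ 2)) := by
    simpa using integrable_exp_neg_mul_sq (b := π * r ^ 2) (by positivity)
  have hprod : Integrable (Function.uncurry fun x ξ : ℝ =>
      Complex.exp (-(2 * π * ξ * x) * Complex.I) * (rexp (-π * r ^ 2 * ξ ^ 2) : ℝ))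
      (σ.prod volume) := by
    refine (hgauss.comp_snd σ).mono (by fun_prop) (ae_of_all _ fun p => ?_)
    have : -(2 * π * p.2 * p.1) * Complex.I = ((-(2 * π * p.2 * p.1) : ℝ) : ℂ) * Complex.I := by
      push_cast; ring
    simp only [Function.uncurry, norm_mul, this, Complex.norm_exp_ofReal_mul_I, one_mul,
      Complex.norm_real, le_refl]
  have key : ((∫ x, rexp (-π * x ^ 2 / r ^ 2) ∂σ : ℝ) : ℂ) =
      r * ∫ ξ : ℝ, measureFourier σ ξ * (rexp (-π * r ^ 2 * ξ ^ 2) : ℝ) := by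
    rw [← integral_complex_ofReal]
    simp_rw [ofReal_exp_neg_sq_div_eq_integral hr]
    rw [integral_const_mul, integral_integral_swap hprod]
    simp_rw [integral_mul_const, measureFourier]
  have hnn : 0 ≤ ∫ x, rexp (-π * x ^ 2 / r ^ 2) ∂σ := integral_nonneg fun x => (exp_pos _).le
  rw [← ofReal_integral_eq_lintegral_ofReal hint (ae_of_all _ fun x => (exp_pos _).le)]
  calc ENNReal.ofReal (∫ x, rexp (-π * x ^ 2 / r ^ 2) ∂σ)
      = ‖((∫ x, rexp (-π * x ^ 2 / r ^ 2) ∂σ : ℝ) : ℂ)‖ₑ := by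
        rw [← ofReal_norm, Complex.norm_real, norm_of_nonneg hnn]
    _ ≤ _ := by
        rw [key, enorm_mul, ← ofReal_norm (r : ℂ), Complex.norm_real,
          norm_of_nonneg hr.le]
        gcongr
        refine (enorm_integral_le_lintegral_enorm _).trans_eq ?_
        refine lintegral_congr fun ξ => ?_
        rw [← ofReal_norm, norm_mul, Complex.norm_real, norm_of_nonneg (exp_pos _).le]

lemma exp_neg_pi_mul_sq_le_rpow {s u : ℝ} (hs0 : 0 ≤ s) (hs : s ≤ 1) (hu : 0 < u) :
    rexp (-π * u ^ 2) ≤ u ^ (s - 1) := by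
  rcases le_total u 1 with h | h
  · calc rexp (-π * u ^ 2) ≤ 1 := by
          rw [exp_le_one_iff, neg_mul]; exact neg_nonpos.2 (by positivity)
      _ ≤ u ^ (s - 1) := one_le_rpow_of_pos_of_le_one_of_nonpos hu h (by linarith)
  · calc rexp (-π * u ^ 2) ≤ u⁻¹ := by
          rw [neg_mul, exp_neg]
          gcongr
          have := add_one_le_exp (π * u ^ 2)
          nlinarith [pi_gt_three]
      _ = u ^ (-1 : ℝ) := (rpow_neg_one u).symm
      _ ≤ u ^ (s - 1) := rpow_le_rpow_of_exponent_le h (by linarith)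

/-- A finite Fourier energy controls the average mass of balls of radius `r`. -/
lemma lintegral_measure_closedBall_le (μ : Measure ℝ) [IsFiniteMeasure μ] {s r : ℝ} (hs0 : 0 ≤ s)
    (hs : s ≤ 1) (hr : 0 < r) :
    ∫⁻ x, μ (Metric.closedBall x r) ∂μ ≤ ENNReal.ofReal (rexp π) * (ENNReal.ofReal (r ^ s) *
      ∫⁻ ξ : ℝ, ENNReal.ofReal (‖measureFourier μ ξ‖ ^ 2 * |ξ| ^ (s - 1))) := by
  have h1 : ∫⁻ x, μ (Metric.closedBall x r) ∂μ ≤ ENNReal.ofReal (rexp π) *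
      ∫⁻ x, ENNReal.ofReal (rexp (-π * x ^ 2 / r ^ 2)) ∂(diffMeasure μ μ) := by
    rw [diffMeasure, lintegral_map (by fun_prop) (by fun_prop),
      lintegral_prod _ (by fun_prop), ← lintegral_const_mul' _ _ ENNReal.ofReal_ne_top]
    refine lintegral_mono fun x => ?_
    rw [← lintegral_const_mul' _ _ ENNReal.ofReal_ne_top,
      ← lintegral_indicator_one Metric.isClosed_closedBall.measurableSet]
    refine lintegral_mono fun y => ?_
    by_cases hy : y ∈ Metric.closedBall x r
    swap
    · simp [hy]
    rw [Set.indicator_of_mem hy, Pi.one_apply, ← ENNReal.ofReal_mul (exp_pos _).le, ← exp_add, ENNReal.one_le_ofReal,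
      one_le_exp_iff]
    have h2 : (x - y) ^ 2 / r ^ 2 ≤ 1 := by
      rw [div_le_one (by positivity), sq_le_sq, abs_of_pos hr, ← Real.dist_eq, dist_comm]
      exact hy
    have h3 := mul_le_mul_of_nonneg_left h2 pi_pos.le
    have h4 : -π * (x - y) ^ 2 / r ^ 2 = -(π * ((x - y) ^ 2 / r ^ 2)) := by ring
    simp only
    linarith
  refine h1.trans ?_
  gcongr
  refine (lintegral_gaussian_le _ hr).trans ?_
  rw [← lintegral_const_mul' _ _ ENNReal.ofReal_ne_top,
    ← lintegral_const_mul' _ _ ENNReal.ofReal_ne_top]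
  have h0 : ∀ᵐ ξ : ℝ, ξ ≠ 0 := Measure.ae_ne volume 0
  refine lintegral_mono_ae (h0.mono fun ξ hξ => ?_)
  rw [← ENNReal.ofReal_mul hr.le, ← ENNReal.ofReal_mul (by positivity)]
  refine ENNReal.ofReal_le_ofReal ?_
  have hpos : 0 < |ξ| := abs_pos.2 hξ
  have hexp := exp_neg_pi_mul_sq_le_rpow hs0 hs (mul_pos hr hpos)
  rw [measureFourier_diffMeasure, norm_mul, RCLike.norm_conj, ← sq]
  calc r * (‖measureFourier μ ξ‖ ^ 2 * rexp (-π * r ^ 2 * ξ ^ 2))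
      = r * (‖measureFourier μ ξ‖ ^ 2 * rexp (-π * (r * |ξ|) ^ 2)) := by
        rw [mul_pow, sq_abs, mul_assoc (-π)]
    _ ≤ r * (‖measureFourier μ ξ‖ ^ 2 * (r * |ξ|) ^ (s - 1)) := by gcongr
    _ = r * r ^ (s - 1) * (‖measureFourier μ ξ‖ ^ 2 * |ξ| ^ (s - 1)) := by
        rw [mul_rpow hr.le hpos.le]; ring
    _ = r ^ s * (‖measureFourier μ ξ‖ ^ 2 * |ξ| ^ (s - 1)) := by
        rw [mul_comm r, ← rpow_add_one hr.ne', sub_add_cancel]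

lemma measurable_measure_closedBall (μ : Measure ℝ) [SFinite μ] (r : ℝ) :
    Measurable fun x => μ (Metric.closedBall x r) := by
  have h : MeasurableSet {p : ℝ × ℝ | dist p.2 p.1 ≤ r} :=
    (isClosed_le (by fun_prop) (by fun_prop)).measurableSet
  exact measurable_measure_prodMk_left (ν := μ) h

/-- If the mass of dyadic balls centred in `F` decays like `M * (1/2)^(k t)`, then `μ` restricted
to `F` is dominated by a multiple of the `t`-dimensional Hausdorff measure. -/
lemma smul_restrict_le_hausdorffMeasure (μ : Measure ℝ) {t : ℝ} (ht : 0 < t) {F : Set ℝ}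
    (hF : MeasurableSet F) {M : ℝ≥0∞} (hM0 : M ≠ 0) (hM : M ≠ ⊤)
    (h : ∀ x ∈ F, ∀ k : ℕ, μ (Metric.closedBall x ((1 / 2) ^ k)) ≤
      M * ENNReal.ofReal (((1 / 2) ^ k) ^ t)) :
    (M * ENNReal.ofReal (2 ^ t))⁻¹ • μ.restrict F ≤ Measure.hausdorffMeasure t := by
  have hc0 : M * ENNReal.ofReal (2 ^ t) ≠ 0 :=
    mul_ne_zero hM0 (ENNReal.ofReal_pos.2 (by positivity)).ne'
  have hc : M * ENNReal.ofReal (2 ^ t) ≠ ⊤ := ENNReal.mul_ne_top hM ENNReal.ofReal_ne_top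
  refine Measure.le_hausdorffMeasure t _ 1 one_pos fun S hS => ?_
  rw [Measure.smul_apply, Measure.restrict_apply' hF, smul_eq_mul,
    ENNReal.inv_mul_le_iff hc0 hc]
  rcases (S ∩ F).eq_empty_or_nonempty with he | ⟨x, hxS, hxF⟩
  · simp [he]
  have hfin : Metric.ediam S ≠ ⊤ := ne_top_of_le_ne_top ENNReal.one_ne_top hS
  set d := (Metric.ediam S).toReal with hd
  have hdS : Metric.ediam S = ENNReal.ofReal d := (ENNReal.ofReal_toReal hfin).symm
  have hd1 : d ≤ 1 := ENNReal.toReal_le_of_le_ofReal zero_le_one (by simpa using hS)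
  have hsub : ∀ ρ, d ≤ ρ → S ∩ F ⊆ Metric.closedBall x ρ := fun ρ hρ y hy =>
    (Metric.dist_le_diam_of_mem' hfin hy.1 hxS).trans hρ
  have hd0 : 0 ≤ d := ENNReal.toReal_nonneg
  rcases hd0.eq_or_lt with h0 | hpos
  · have hlim : Filter.Tendsto (fun k : ℕ => M * ENNReal.ofReal (((1 / 2 : ℝ) ^ k) ^ t))
        Filter.atTop (nhds 0) := by
      have h1 : Filter.Tendsto (fun k : ℕ => ((1 / 2 : ℝ) ^ k) ^ t) Filter.atTop (nhds 0) := by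
        have := (tendsto_pow_atTop_nhds_zero_of_lt_one (r := (1 / 2 : ℝ)) (by norm_num)
          (by norm_num)).rpow_const (p := t) (Or.inr ht.le)
        rwa [zero_rpow ht.ne'] at this
      have h2 := ENNReal.Tendsto.const_mul (a := M) (ENNReal.tendsto_ofReal h1) (Or.inr hM)
      simpa using h2
    have : μ (S ∩ F) ≤ 0 := ge_of_tendsto' hlim fun k =>
      (measure_mono (hsub _ (by rw [← h0]; positivity))).trans (h x hxF k)
    exact this.trans zero_le
  · obtain ⟨k, hk1, hk2⟩ := exists_nat_pow_near_of_lt_one hpos hd1 (y := (1 / 2 : ℝ))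
      (by norm_num) (by norm_num)
    refine (measure_mono (hsub _ hk2)).trans ((h x hxF k).trans ?_)
    rw [hdS, ENNReal.ofReal_rpow_of_pos hpos, mul_assoc, ← ENNReal.ofReal_mul (by positivity),
      ← mul_rpow (by norm_num) hd0]
    gcongr
    rw [pow_succ] at hk1
    linarith

lemma hausdorffMeasure_ne_zero_of_lintegral_closedBall_le (μ : Measure ℝ) [IsFiniteMeasure μ]
    (hμ : μ ≠ 0) {E : Set ℝ} (hE : μ Eᶜ = 0) {s t : ℝ} (ht : 0 < t) (hts : t < s) {C : ℝ≥0∞}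
    (hC : C ≠ ⊤) (h : ∀ r : ℝ, 0 < r →
      ∫⁻ x, μ (Metric.closedBall x r) ∂μ ≤ C * ENNReal.ofReal (r ^ s)) :
    Measure.hausdorffMeasure t E ≠ 0 := by
  set f : ℝ → ℝ≥0∞ := fun x => ∑' k : ℕ, ENNReal.ofReal (((1 / 2) ^ k) ^ (-t)) *
    μ (Metric.closedBall x ((1 / 2) ^ k)) with hf
  have hfm : Measurable f := Measurable.tsum fun k =>
    (measurable_measure_closedBall μ _).const_mul _
  have hfi : ∫⁻ x, f x ∂μ ≠ ⊤ := by
    rw [hf, lintegral_tsum fun k => ((measurable_measure_closedBall μ _).const_mul _).aemeasurable]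
    have hq0 : (0 : ℝ) ≤ (1 / 2) ^ (s - t) := by positivity
    have hq : ((1 / 2 : ℝ)) ^ (s - t) < 1 :=
      rpow_lt_one (by norm_num) (by norm_num) (by linarith)
    have hle : ∀ k : ℕ, ∫⁻ x, ENNReal.ofReal (((1 / 2) ^ k) ^ (-t)) *
        μ (Metric.closedBall x ((1 / 2) ^ k)) ∂μ ≤
        C * ENNReal.ofReal (((1 / 2 : ℝ) ^ (s - t)) ^ k) := by
      intro k
      rw [lintegral_const_mul' _ _ ENNReal.ofReal_ne_top]
      calc _ ≤ ENNReal.ofReal (((1 / 2) ^ k) ^ (-t)) *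
            (C * ENNReal.ofReal (((1 / 2) ^ k) ^ s)) := by
            gcongr; exact h _ (by positivity)
        _ = C * ENNReal.ofReal (((1 / 2 : ℝ) ^ (s - t)) ^ k) := by
            rw [mul_left_comm, ← ENNReal.ofReal_mul (by positivity),
              ← rpow_add (by positivity), ← rpow_natCast, ← rpow_natCast, ← rpow_mul (by norm_num),
              ← rpow_mul (by norm_num)]
            congr 3
            ring
    refine ne_top_of_le_ne_top ?_ (ENNReal.tsum_le_tsum hle)
    rw [ENNReal.tsum_mul_left, ← ENNReal.ofReal_tsum_of_nonneg (fun k => by positivity)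
      (summable_geometric_of_lt_one hq0 hq)]
    exact ENNReal.mul_ne_top hC ENNReal.ofReal_ne_top
  have hae : ∀ᵐ x ∂μ, f x < ⊤ := ae_lt_top hfm hfi
  obtain ⟨n, hn⟩ : ∃ n : ℕ, μ {x | f x ≤ (n + 1 : ℕ)} ≠ 0 := by
    by_contra! hall
    refine hμ (Measure.measure_univ_eq_zero.1 (measure_mono_null (t := {x | ¬ f x < ⊤} ∪
      ⋃ n : ℕ, {x | f x ≤ (n + 1 : ℕ)}) (fun x _ => ?_) (measure_union_null hae
        (measure_iUnion_null hall))))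
    by_cases hx : f x < ⊤
    · obtain ⟨n, hn⟩ := ENNReal.exists_nat_gt hx.ne
      refine Or.inr (Set.mem_iUnion.2 ⟨n, hn.le.trans ?_⟩)
      exact_mod_cast n.le_succ
    · exact Or.inl hx
  set F := {x | f x ≤ (n + 1 : ℕ)} with hFdef
  have hF : MeasurableSet F := hfm measurableSet_Iic
  have hM0 : ((n + 1 : ℕ) : ℝ≥0∞) ≠ 0 := by simp
  have hM : ((n + 1 : ℕ) : ℝ≥0∞) ≠ ⊤ := ENNReal.natCast_ne_top _
  have hball : ∀ x ∈ F, ∀ k : ℕ, μ (Metric.closedBall x ((1 / 2) ^ k)) ≤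
      ((n + 1 : ℕ) : ℝ≥0∞) * ENNReal.ofReal (((1 / 2) ^ k) ^ t) := by
    intro x hx k
    have h1 := (ENNReal.le_tsum (f := fun k : ℕ => ENNReal.ofReal (((1 / 2) ^ k) ^ (-t)) *
      μ (Metric.closedBall x ((1 / 2) ^ k))) k).trans hx
    have hp : (0 : ℝ) < ((1 / 2) ^ k) ^ t := by positivity
    rw [rpow_neg (by positivity), ENNReal.ofReal_inv_of_pos hp,
      ENNReal.inv_mul_le_iff (ENNReal.ofReal_pos.2 hp).ne' ENNReal.ofReal_ne_top, mul_comm] at h1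
    exact h1
  have hle := smul_restrict_le_hausdorffMeasure μ ht hF hM0 hM hball E
  have hFE : μ (E ∩ F) ≠ 0 := fun h0 => hn <| by
    refine measure_mono_null (t := Eᶜ ∪ (E ∩ F)) (fun x hx => ?_) (measure_union_null hE h0)
    by_cases hxE : x ∈ E
    · exact Or.inr ⟨hxE, hx⟩
    · exact Or.inl hxE
  intro h0
  rw [h0, Measure.smul_apply, Measure.restrict_apply' hF, smul_eq_mul, nonpos_iff_eq_zero,
    mul_eq_zero, ENNReal.inv_eq_zero] at hle
  exact hle.elim (ENNReal.mul_ne_top hM ENNReal.ofReal_ne_top) hFE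

/-- A set carrying a nonzero finite measure of finite `s`-energy has dimension at least `s`. -/
lemma le_dimH_of_lintegral_measureFourier_sq_lt_top (μ : Measure ℝ) [IsFiniteMeasure μ]
    (hμ : μ ≠ 0) {E : Set ℝ} (hE : μ Eᶜ = 0) {s : ℝ} (hs0 : 0 ≤ s) (hs : s ≤ 1)
    (h : ∫⁻ ξ : ℝ, ENNReal.ofReal (‖measureFourier μ ξ‖ ^ 2 * |ξ| ^ (s - 1)) < ⊤) :
    ENNReal.ofReal s ≤ dimH E := by
  refine le_of_forall_lt fun a ha => ?_
  obtain ⟨t, hat, hts⟩ := ENNReal.lt_iff_exists_nnreal_btwn.1 ha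
  have ht : 0 < (t : ℝ) := by exact_mod_cast pos_of_gt hat
  have hts' : (t : ℝ) < s := by
    rw [← ENNReal.ofReal_coe_nnreal] at hts
    exact (ENNReal.ofReal_lt_ofReal_iff_of_nonneg t.2).1 hts
  refine hat.trans_le (le_dimH_of_hausdorffMeasure_ne_zero ?_)
  refine hausdorffMeasure_ne_zero_of_lintegral_closedBall_le μ hμ hE ht hts'
    (ENNReal.mul_ne_top (ENNReal.ofReal_ne_top (r := rexp π)) h.ne) fun r hr => ?_
  refine (lintegral_measure_closedBall_le μ hs0 hs hr).trans_eq ?_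
  ring

/-- Hölder's inequality for the energies of `μ`, `ν` and of their difference measure. -/
lemma lintegral_measureFourier_diffMeasure_le (μ ν : Measure ℝ) [IsFiniteMeasure μ]
    [IsFiniteMeasure ν] {θ α β : ℝ} (hθ : θ ∈ Set.Ioo (0 : ℝ) 1) :
    ∫⁻ ξ : ℝ, ENNReal.ofReal
        (‖measureFourier (diffMeasure μ ν) ξ‖ ^ 2 * |ξ| ^ (α + β - 1)) ≤
      energyJ μ α θ * energyJ ν β (1 - θ) := by
  obtain ⟨hθ0, hθ1⟩ := hθ
  have hθ' : 0 < 1 - θ := by linarith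
  have hconj : (1 / θ).HolderConjugate (1 / (1 - θ)) := by
    rw [Real.holderConjugate_iff]
    refine ⟨(one_lt_div hθ0).2 hθ1, ?_⟩
    simp
  have hmeas : ∀ (ρ : Measure ℝ) [IsFiniteMeasure ρ] (γ : ℝ), AEMeasurable (fun ξ : ℝ =>
      ENNReal.ofReal (‖measureFourier ρ ξ‖ ^ 2 * |ξ| ^ γ)) := fun ρ _ γ => by
    have := measurable_measureFourier ρ
    fun_prop
  have hpow : ∀ (ρ : Measure ℝ) (γ η : ℝ), 0 < η →
      (∫⁻ ξ : ℝ, ENNReal.ofReal (‖measureFourier ρ ξ‖ ^ 2 * |ξ| ^ (γ - η)) ^ (1 / η)) ^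
        (1 / (1 / η)) = energyJ ρ γ η := by
    intro ρ γ η hη
    rw [energyJ, one_div_one_div]
    congr 1
    refine lintegral_congr fun ξ => ?_
    rw [ENNReal.ofReal_rpow_of_nonneg (by positivity) (by positivity),
      mul_rpow (by positivity) (by positivity), ← rpow_natCast, ← rpow_mul (norm_nonneg _),
      ← rpow_mul (abs_nonneg _)]
    congr 3
    · push_cast; ring
    · field_simp
  have hH := ENNReal.lintegral_mul_le_Lp_mul_Lq volume hconj (hmeas μ (α - θ))
    (hmeas ν (β - (1 - θ)))
  rw [hpow μ α θ hθ0, hpow ν β (1 - θ) hθ'] at hH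
  refine le_trans (lintegral_mono_ae ((Measure.ae_ne volume (0 : ℝ)).mono fun ξ hξ => ?_)) hH
  have hpos : 0 < |ξ| := abs_pos.2 hξ
  rw [Pi.mul_apply, ← ENNReal.ofReal_mul (by positivity), measureFourier_diffMeasure, norm_mul,
    RCLike.norm_conj]
  refine ENNReal.ofReal_le_ofReal (le_of_eq ?_)
  rw [show α + β - 1 = (α - θ) + (β - (1 - θ)) by ring, rpow_add hpos]
  ring

lemma diffMeasure_ne_zero {μ ν : Measure ℝ} [SFinite ν] (hμ : μ ≠ 0) (hν : ν ≠ 0) :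
    diffMeasure μ ν ≠ 0 := by
  rw [diffMeasure, Ne, Measure.map_eq_zero_iff (by fun_prop), ← Measure.measure_univ_eq_zero,
    ← Set.univ_prod_univ, Measure.prod_prod, mul_eq_zero, Measure.measure_univ_eq_zero,
    Measure.measure_univ_eq_zero]
  tauto

lemma diffMeasure_compl_eq_zero {μ ν : Measure ℝ} [SFinite μ] [SFinite ν] {A B : Set ℝ}
    (hA : IsCompact A) (hB : IsCompact B) (hμ : μ Aᶜ = 0) (hν : ν Bᶜ = 0) :
    diffMeasure μ ν {d : ℝ | ∃ a ∈ A, ∃ b ∈ B, a - b = d}ᶜ = 0 := by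
  have hD : {d : ℝ | ∃ a ∈ A, ∃ b ∈ B, a - b = d} = (fun p : ℝ × ℝ => p.1 - p.2) '' (A ×ˢ B) := by
    ext d
    simp only [Set.mem_ofPred_eq, Set.mem_image, Set.mem_prod, Prod.exists]
    grind
  have hc : IsCompact ((fun p : ℝ × ℝ => p.1 - p.2) '' (A ×ˢ B)) :=
    (hA.prod hB).image (by fun_prop)
  rw [hD, diffMeasure, Measure.map_apply (by fun_prop) hc.measurableSet.compl]
  refine measure_mono_null (t := (Aᶜ ×ˢ Set.univ) ∪ (Set.univ ×ˢ Bᶜ)) (fun p hp => ?_)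
    (measure_union_null (by rw [Measure.prod_prod, hμ, zero_mul])
      (by rw [Measure.prod_prod, hν, mul_zero]))
  by_contra hcon
  simp only [Set.mem_union, Set.mem_prod, Set.mem_compl_iff, Set.mem_univ, and_true, true_and,
    not_or, not_not] at hcon
  exact hp ⟨p, hcon, rfl⟩

/-- if compact `A, B ⊆ ℝ` carry nonzero finite measures `μ, ν` with
`J_{α,θ}(μ) < ∞` and `J_{β,1-θ}(ν) < ∞`, where `θ ∈ (0,1)`, `α, β > 0`, `α + β ≤ 1`,
then `dim_H (A - B) ≥ α + β`. -/
theorem stmt_16 (A B : Set ℝ) (hA : IsCompact A) (hB : IsCompact B)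
    (θ α β : ℝ) (hθ : θ ∈ Set.Ioo (0 : ℝ) 1) (hα : 0 < α) (hβ : 0 < β)
    (hαβ : α + β ≤ 1)
    (μ ν : Measure ℝ) [IsFiniteMeasure μ] [IsFiniteMeasure ν]
    (hμ : μ ≠ 0) (hν : ν ≠ 0) (hμsupp : μ Aᶜ = 0) (hνsupp : ν Bᶜ = 0)
    (hμE : energyJ μ α θ < ⊤) (hνE : energyJ ν β (1 - θ) < ⊤) :
    ENNReal.ofReal (α + β) ≤ dimH {d : ℝ | ∃ a ∈ A, ∃ b ∈ B, a - b = d} := by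
  refine le_dimH_of_lintegral_measureFourier_sq_lt_top (diffMeasure μ ν)
    (diffMeasure_ne_zero hμ hν) (diffMeasure_compl_eq_zero hA hB hμsupp hνsupp)
    (add_pos hα hβ).le hαβ ?_
  exact (lintegral_measureFourier_diffMeasure_le μ ν hθ).trans_lt (ENNReal.mul_lt_top hμE hνE)
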